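/- The value (−17 − 7√7)/27 is the greatest element of the set of all real numbers m such that m = infimum over real θ of cos(a₁θ) + cos(a₂θ) + cos(a₃θ) for some positive integers a₁ < a₂ < a₃. Equivalently: for all positive integers a₁ < a₂ < a₃, the infimum over θ ∈ ℝ of cos(a₁θ) + cos(a₂θ) + cos(a₃θ) is at most (−17 − 7√7)/27, and this infimum equals (−17 − 7√7)/27 when (a₁, a₂, a₃) = (1, 2, 3). (This says λ(3) = (17 + 7√7)/27.) -/

import Mathlib

/-- The sum of `cos (m θ)` over the `n` solutions of `n θ = t` modulo `2π` vanishes unless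
`n ∣ m`. -/
theorem sum_cos_equispaced_eq_zero {n : ℕ} (hn : 0 < n) {m : ℤ} (hm : ¬ (n : ℤ) ∣ m) (t : ℝ) :
    ∑ k ∈ Finset.range n, Real.cos (m * ((t + 2 * Real.pi * k) / n)) = 0 := by
  have hn' : (n : ℝ) ≠ 0 := by positivity
  have hsin : Real.sin (Real.pi * m / n) ≠ 0 := by
    intro h
    obtain ⟨j, hj⟩ := Real.sin_eq_zero_iff.mp h
    apply hm
    refine ⟨j, ?_⟩
    have h1 : (j : ℝ) * n * Real.pi = m * Real.pi := by
      rw [eq_div_iff hn'] at hj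
      linarith
    have h2 := mul_right_cancel₀ Real.pi_ne_zero h1
    have h3 : j * (n : ℤ) = m := by exact_mod_cast h2
    rw [← h3, mul_comm]
  set F : ℕ → ℝ := fun k => Real.sin (m * t / n + Real.pi * m / n * (2 * k - 1)) with hF
  have htel : ∀ k ∈ Finset.range n,
      2 * Real.sin (Real.pi * m / n) * Real.cos (m * ((t + 2 * Real.pi * k) / n)) =
        F (k + 1) - F k := by
    intro k _
    have e1 : m * t / n + Real.pi * m / n * (2 * ((k + 1 : ℕ) : ℝ) - 1) =
        m * ((t + 2 * Real.pi * k) / n) + Real.pi * m / n := by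
      push_cast; ring
    have e2 : m * t / n + Real.pi * m / n * (2 * (k : ℝ) - 1) =
        m * ((t + 2 * Real.pi * k) / n) - Real.pi * m / n := by
      ring
    simp only [hF]
    rw [e1, e2, Real.sin_add, Real.sin_sub]
    ring
  have hsum := Finset.sum_congr rfl htel
  rw [Finset.sum_range_sub, ← Finset.mul_sum] at hsum
  have hper : Real.sin (m * t / n + Real.pi * m / n * (2 * (n : ℝ) - 1)) =
      Real.sin (m * t / n + Real.pi * m / n * (2 * ((0 : ℕ) : ℝ) - 1)) := by
    have e : m * t / n + Real.pi * m / n * (2 * (n : ℝ) - 1) =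
        m * t / n + Real.pi * m / n * (2 * ((0 : ℕ) : ℝ) - 1) + m * (2 * Real.pi) := by
      push_cast
      field_simp
      ring
    rw [e, Real.sin_add_int_mul_two_pi]
  simp only [hF, hper, sub_self] at hsum
  exact (mul_eq_zero.mp hsum).resolve_left (mul_ne_zero two_ne_zero hsin)

theorem cos_nat_mul_equispaced {n : ℕ} (hn : 0 < n) (t : ℝ) (k : ℕ) :
    Real.cos (n * ((t + 2 * Real.pi * k) / n)) = Real.cos t := by
  have hn' : (n : ℝ) ≠ 0 := by positivity
  have e : n * ((t + 2 * Real.pi * k) / n) = t + k * (2 * Real.pi) := by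
    field_simp
  rw [e, Real.cos_add_nat_mul_two_pi]

/-- A second moment bound over the `n` solutions of `cos (n θ) = -1`. -/
theorem exists_cos_add_cos_lt {n : ℕ} (hn : 0 < n) {p q : ℤ}
    (hp : ¬ (n : ℤ) ∣ p) (hq : ¬ (n : ℤ) ∣ q) (hp2 : ¬ (n : ℤ) ∣ 2 * p) (hq2 : ¬ (n : ℤ) ∣ 2 * q)
    (hadd : ¬ (n : ℤ) ∣ p + q) (hsub : ¬ (n : ℤ) ∣ p - q) :
    ∃ θ : ℝ, Real.cos (n * θ) = -1 ∧ Real.cos (p * θ) + Real.cos (q * θ) < -2 / 5 := by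
  by_contra! H
  have hpt : ∀ k : ℕ, 0 ≤ -(1 / 5 : ℝ)
      + 8 / 5 * Real.cos (p * ((Real.pi + 2 * Real.pi * k) / n))
      + 8 / 5 * Real.cos (q * ((Real.pi + 2 * Real.pi * k) / n))
      - 1 / 2 * Real.cos ((2 * p : ℤ) * ((Real.pi + 2 * Real.pi * k) / n))
      - 1 / 2 * Real.cos ((2 * q : ℤ) * ((Real.pi + 2 * Real.pi * k) / n))
      - Real.cos ((p + q : ℤ) * ((Real.pi + 2 * Real.pi * k) / n))
      - Real.cos ((p - q : ℤ) * ((Real.pi + 2 * Real.pi * k) / n)) := by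
    intro k
    have h := H ((Real.pi + 2 * Real.pi * k) / n)
      ((cos_nat_mul_equispaced hn Real.pi k).trans Real.cos_pi)
    generalize (Real.pi + 2 * Real.pi * k) / n = θ at h ⊢
    push_cast
    rw [mul_assoc 2, mul_assoc 2, Real.cos_two_mul, Real.cos_two_mul, add_mul, sub_mul,
      Real.cos_add, Real.cos_sub]
    nlinarith [mul_nonneg (sub_nonneg.mpr h) (add_nonneg
      (sub_nonneg.mpr (Real.cos_le_one (p * θ))) (sub_nonneg.mpr (Real.cos_le_one (q * θ))))]
  have hsum := Finset.sum_nonneg fun k (_ : k ∈ Finset.range n) => hpt k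
  simp only [Finset.sum_add_distrib, Finset.sum_sub_distrib, ← Finset.mul_sum] at hsum
  rw [sum_cos_equispaced_eq_zero hn hp, sum_cos_equispaced_eq_zero hn hq,
    sum_cos_equispaced_eq_zero hn hp2, sum_cos_equispaced_eq_zero hn hq2,
    sum_cos_equispaced_eq_zero hn hadd, sum_cos_equispaced_eq_zero hn hsub] at hsum
  simp only [Finset.sum_const, Finset.card_range, nsmul_eq_mul] at hsum
  have : (0 : ℝ) < n := by exact_mod_cast hn
  linarith

/-- A second moment bound over the `n` solutions of `n θ = t` modulo `2π`. -/
theorem exists_cos_lt {n : ℕ} (hn : 0 < n) {p : ℤ}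
    (hp : ¬ (n : ℤ) ∣ p) (hp2 : ¬ (n : ℤ) ∣ 2 * p) (t : ℝ) :
    ∃ θ : ℝ, (∃ k : ℕ, n * θ = t + k * (2 * Real.pi)) ∧ Real.cos (p * θ) < -2 / 5 := by
  have hn' : (0 : ℝ) < n := by exact_mod_cast hn
  by_contra! H
  have hpt : ∀ k : ℕ, 0 ≤ -(1 / 10 : ℝ)
      + 3 / 5 * Real.cos (p * ((t + 2 * Real.pi * k) / n))
      - 1 / 2 * Real.cos ((2 * p : ℤ) * ((t + 2 * Real.pi * k) / n)) := by
    intro k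
    have h := H ((t + 2 * Real.pi * k) / n) ⟨k, by field_simp⟩
    generalize (t + 2 * Real.pi * k) / n = θ at h ⊢
    push_cast
    rw [mul_assoc 2, Real.cos_two_mul]
    nlinarith [mul_nonneg (sub_nonneg.mpr h) (sub_nonneg.mpr (Real.cos_le_one (p * θ)))]
  have hsum := Finset.sum_nonneg fun k (_ : k ∈ Finset.range n) => hpt k
  simp only [Finset.sum_add_distrib, Finset.sum_sub_distrib, ← Finset.mul_sum] at hsum
  rw [sum_cos_equispaced_eq_zero hn hp, sum_cos_equispaced_eq_zero hn hp2] at hsum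
  simp only [Finset.sum_const, Finset.card_range, nsmul_eq_mul] at hsum
  linarith

theorem cos_two_pi_div_three : Real.cos (2 * Real.pi / 3) = -1 / 2 := by
  rw [show 2 * Real.pi / 3 = Real.pi - Real.pi / 3 by ring, Real.cos_pi_sub,
    Real.cos_pi_div_three]
  norm_num

/-- The cosine sum with frequencies `a, b, c` takes a value at most `v`. -/
def CosSumAttainsLE (v : ℝ) (a b c : ℕ) : Prop :=
  ∃ θ : ℝ, Real.cos (a * θ) + Real.cos (b * θ) + Real.cos (c * θ) ≤ v

theorem CosSumAttainsLE.mul_left {v : ℝ} {a b c : ℕ} (h : CosSumAttainsLE v a b c) {d : ℕ}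
    (hd : 0 < d) : CosSumAttainsLE v (d * a) (d * b) (d * c) := by
  obtain ⟨θ, hθ⟩ := h
  have hd' : (d : ℝ) ≠ 0 := by positivity
  refine ⟨θ / d, ?_⟩
  have e (x : ℕ) : ((d * x : ℕ) : ℝ) * (θ / d) = x * θ := by
    push_cast
    field_simp
  rwa [e, e, e]

theorem CosSumAttainsLE.mono {v w : ℝ} {a b c : ℕ} (h : CosSumAttainsLE v a b c) (hvw : v ≤ w) :
    CosSumAttainsLE w a b c :=
  h.imp fun _ hθ => hθ.trans hvw

theorem cos_nat_mul_arccos {x : ℝ} (h₁ : -1 ≤ x) (h₂ : x ≤ 1) (n : ℕ) :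
    Real.cos (n * Real.arccos x) = (Polynomial.Chebyshev.T ℝ n).eval x := by
  have h := Polynomial.Chebyshev.T_real_cos (Real.arccos x) n
  rw [Real.cos_arccos h₁ h₂] at h
  exact_mod_cast h.symm

theorem chebyshev_eval_succ_succ (x : ℝ) (n : ℕ) :
    (Polynomial.Chebyshev.T ℝ ((n + 2 : ℕ) : ℤ)).eval x =
      2 * x * (Polynomial.Chebyshev.T ℝ ((n + 1 : ℕ) : ℤ)).eval x -
        (Polynomial.Chebyshev.T ℝ (n : ℤ)).eval x := by
  push_cast
  rw [Polynomial.Chebyshev.T_add_two]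
  simp

theorem cosSumAttainsLE_of_chebyshev {v x : ℝ} (h₁ : -1 ≤ x) (h₂ : x ≤ 1) {a b c : ℕ}
    (h : (Polynomial.Chebyshev.T ℝ a).eval x + (Polynomial.Chebyshev.T ℝ b).eval x +
      (Polynomial.Chebyshev.T ℝ c).eval x ≤ v) : CosSumAttainsLE v a b c :=
  ⟨Real.arccos x, by simpa only [cos_nat_mul_arccos h₁ h₂] using h⟩

theorem chebyshev_eval_small (x : ℝ) :
    (Polynomial.Chebyshev.T ℝ ((1 : ℕ) : ℤ)).eval x = x ∧
    (Polynomial.Chebyshev.T ℝ ((2 : ℕ) : ℤ)).eval x = 2 * x ^ 2 - 1 ∧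
    (Polynomial.Chebyshev.T ℝ ((3 : ℕ) : ℤ)).eval x = 4 * x ^ 3 - 3 * x ∧
    (Polynomial.Chebyshev.T ℝ ((4 : ℕ) : ℤ)).eval x = 8 * x ^ 4 - 8 * x ^ 2 + 1 ∧
    (Polynomial.Chebyshev.T ℝ ((5 : ℕ) : ℤ)).eval x = 16 * x ^ 5 - 20 * x ^ 3 + 5 * x ∧
    (Polynomial.Chebyshev.T ℝ ((6 : ℕ) : ℤ)).eval x =
      32 * x ^ 6 - 48 * x ^ 4 + 18 * x ^ 2 - 1 ∧
    (Polynomial.Chebyshev.T ℝ ((7 : ℕ) : ℤ)).eval x =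
      64 * x ^ 7 - 112 * x ^ 5 + 56 * x ^ 3 - 7 * x ∧
    (Polynomial.Chebyshev.T ℝ ((8 : ℕ) : ℤ)).eval x =
      128 * x ^ 8 - 256 * x ^ 6 + 160 * x ^ 4 - 32 * x ^ 2 + 1 ∧
    (Polynomial.Chebyshev.T ℝ ((9 : ℕ) : ℤ)).eval x =
      256 * x ^ 9 - 576 * x ^ 7 + 432 * x ^ 5 - 120 * x ^ 3 + 9 * x := by
  have h0 : (Polynomial.Chebyshev.T ℝ ((0 : ℕ) : ℤ)).eval x = 1 := by simp
  have h1 : (Polynomial.Chebyshev.T ℝ ((1 : ℕ) : ℤ)).eval x = x := by simp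
  have h2 := chebyshev_eval_succ_succ x 0
  have h3 := chebyshev_eval_succ_succ x 1
  have h4 := chebyshev_eval_succ_succ x 2
  have h5 := chebyshev_eval_succ_succ x 3
  have h6 := chebyshev_eval_succ_succ x 4
  have h7 := chebyshev_eval_succ_succ x 5
  have h8 := chebyshev_eval_succ_succ x 6
  have h9 := chebyshev_eval_succ_succ x 7
  simp only [Nat.reduceAdd] at h2 h3 h4 h5 h6 h7 h8 h9
  rw [h1, h0] at h2
  rw [h2, h1] at h3
  rw [h3, h2] at h4
  rw [h4, h3] at h5
  rw [h5, h4] at h6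
  rw [h6, h5] at h7
  rw [h7, h6] at h8
  rw [h8, h7] at h9
  rw [h1, h2, h3, h4, h5, h6, h7, h8, h9]
  refine ⟨?_, ?_, ?_, ?_, ?_, ?_, ?_, ?_, ?_⟩ <;> ring

theorem cosSumAttainsLE_sporadic :
    CosSumAttainsLE (-33 / 25) 2 3 4 ∧ CosSumAttainsLE (-33 / 25) 3 4 6 ∧
    CosSumAttainsLE (-33 / 25) 1 2 4 ∧ CosSumAttainsLE (-33 / 25) 1 3 4 ∧
    CosSumAttainsLE (-33 / 25) 2 3 5 ∧ CosSumAttainsLE (-33 / 25) 1 4 5 ∧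
    CosSumAttainsLE (-33 / 25) 3 4 7 ∧ CosSumAttainsLE (-33 / 25) 1 5 6 ∧
    CosSumAttainsLE (-33 / 25) 2 5 7 ∧ CosSumAttainsLE (-33 / 25) 3 5 8 ∧
    CosSumAttainsLE (-33 / 25) 4 5 9 := by
  refine ⟨cosSumAttainsLE_of_chebyshev (x := 1 / 2) ?_ ?_ ?_,
    cosSumAttainsLE_of_chebyshev (x := 2 / 3) ?_ ?_ ?_,
    cosSumAttainsLE_of_chebyshev (x := -1 / 2) ?_ ?_ ?_,
    cosSumAttainsLE_of_chebyshev (x := -5 / 6) ?_ ?_ ?_,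
    cosSumAttainsLE_of_chebyshev (x := 2 / 3) ?_ ?_ ?_,
    cosSumAttainsLE_of_chebyshev (x := -1 / 2) ?_ ?_ ?_,
    cosSumAttainsLE_of_chebyshev (x := 1 / 3) ?_ ?_ ?_,
    cosSumAttainsLE_of_chebyshev (x := -1 / 5) ?_ ?_ ?_,
    cosSumAttainsLE_of_chebyshev (x := -1 / 2) ?_ ?_ ?_,
    cosSumAttainsLE_of_chebyshev (x := 6 / 7) ?_ ?_ ?_,
    cosSumAttainsLE_of_chebyshev (x := 3 / 5) ?_ ?_ ?_⟩
  all_goals first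
    | norm_num; done
    | simp only [chebyshev_eval_small]
      norm_num

theorem cosSumAttainsLE_one_two_three :
    CosSumAttainsLE ((-17 - 7 * Real.sqrt 7) / 27) 1 2 3 := by
  have hs : Real.sqrt 7 ^ 2 = 7 := Real.sq_sqrt (by norm_num)
  have hlo : 0 ≤ Real.sqrt 7 := Real.sqrt_nonneg 7
  have hhi : Real.sqrt 7 ≤ 3 := Real.sqrt_le_iff.mpr (by norm_num)
  refine cosSumAttainsLE_of_chebyshev (x := (Real.sqrt 7 - 1) / 6) (by linarith) (by linarith) ?_
  obtain ⟨h1, h2, h3, -⟩ := chebyshev_eval_small ((Real.sqrt 7 - 1) / 6)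
  rw [h1, h2, h3]
  generalize Real.sqrt 7 = s at hs
  have hs3 : s ^ 3 = 7 * s := by rw [pow_succ, hs]
  nlinarith

theorem neg_le_cos_sum_one_two_three (θ : ℝ) : (-17 - 7 * Real.sqrt 7) / 27 ≤
    Real.cos ((1 : ℕ) * θ) + Real.cos ((2 : ℕ) * θ) + Real.cos ((3 : ℕ) * θ) := by
  have hs : Real.sqrt 7 ^ 2 = 7 := Real.sq_sqrt (by norm_num)
  have hlo : 5 / 2 ≤ Real.sqrt 7 := Real.le_sqrt_of_sq_le (by norm_num)
  push_cast
  rw [one_mul, Real.cos_two_mul, Real.cos_three_mul]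
  have hx := Real.neg_one_le_cos θ
  generalize Real.cos θ = x at hx
  generalize Real.sqrt 7 = s at hs hlo
  have key : 0 ≤ 4 * ((x - (s - 1) / 6) ^ 2 * (x + 1 / 2 + (s - 1) / 3)) :=
    mul_nonneg (by norm_num) (mul_nonneg (sq_nonneg _) (by linarith))
  have e : 4 * ((x - (s - 1) / 6) ^ 2 * (x + 1 / 2 + (s - 1) / 3)) =
      x + (2 * x ^ 2 - 1) + (4 * x ^ 3 - 3 * x) - (-17 - 7 * s) / 27
        + (s ^ 2 - 7) * (s / 27 - x / 3 - 1 / 18) := by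
    ring
  rw [e, hs] at key
  linarith

/-- The frequencies `a, b, a + b` with `a, b` coprime and `b ≥ 6`: on the fibre `b θ = 2π/3`, the
values of `a θ + π/3` are spaced by `2π/b`. -/
theorem cosSumAttainsLE_add_of_coprime {a b : ℕ} (hab : Nat.Coprime a b) (hb : 6 ≤ b) :
    CosSumAttainsLE (-33 / 25) a b (a + b) := by
  have hb' : (6 : ℝ) ≤ b := by exact_mod_cast hb
  have hb0 : (b : ℝ) ≠ 0 := by positivity
  have hpi := Real.pi_pos
  obtain ⟨u, v, huv⟩ := Nat.isCoprime_iff_coprime.mpr hab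
  set s : ℝ := (2 * Real.pi / 3 - a * (2 * Real.pi / 3) / b) * b / (2 * Real.pi) with hs
  set r : ℤ := round s with hr
  have huv' : (u : ℝ) * a + v * b = 1 := by exact_mod_cast huv
  have hround : |s - r| ≤ 1 / 2 := abs_sub_round s
  refine ⟨(2 * Real.pi / 3 + 2 * Real.pi * (u * r)) / b, ?_⟩
  set θ : ℝ := (2 * Real.pi / 3 + 2 * Real.pi * (u * r)) / b with hθ
  have hbθ : b * θ = 2 * Real.pi / 3 + ((u * r : ℤ) : ℝ) * (2 * Real.pi) := by
    rw [hθ]; push_cast; field_simp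
  have haθ : a * θ = (2 * Real.pi / 3 - 2 * Real.pi * (s - r) / b)
      + ((-(v * r) : ℤ) : ℝ) * (2 * Real.pi) := by
    have hua : (u : ℝ) * a = 1 - v * b := by linarith
    have e1 : a * θ = a * (2 * Real.pi / 3) / b + 2 * Real.pi * (u * a) * r / b := by
      rw [hθ]; ring
    rw [e1, hua, hs]; push_cast; field_simp; ring
  set δ : ℝ := 2 * Real.pi * (s - r) / b with hδ
  have hδabs : |δ| ≤ Real.pi / 6 := by
    rw [hδ, abs_div, abs_mul, abs_of_pos (by positivity : 0 < 2 * Real.pi),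
      abs_of_pos (by positivity : (0 : ℝ) < b), div_le_iff₀ (by positivity)]
    nlinarith
  have hcosδ : Real.sqrt 3 / 2 ≤ Real.cos δ := by
    rw [← Real.cos_pi_div_six, ← Real.cos_abs δ]
    exact Real.cos_le_cos_of_nonneg_of_le_pi (abs_nonneg _) (by linarith) hδabs
  have h3 : (17 / 10 : ℝ) ≤ Real.sqrt 3 := Real.le_sqrt_of_sq_le (by norm_num)
  have hsum : Real.cos (a * θ) + Real.cos ((a + b : ℕ) * θ) = -Real.cos δ := by
    have e : ((a + b : ℕ) : ℝ) * θ = (Real.pi + (Real.pi / 3 - δ))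
        + ((u * r - v * r : ℤ) : ℝ) * (2 * Real.pi) := by
      push_cast at hbθ haθ ⊢
      rw [add_mul, haθ, hbθ]; ring
    have e2 : 2 * Real.pi / 3 - δ = Real.pi - (Real.pi / 3 + δ) := by ring
    rw [e, haθ, Real.cos_add_int_mul_two_pi, Real.cos_add_int_mul_two_pi, e2, Real.cos_pi_sub,
      add_comm Real.pi, Real.cos_add_pi, Real.cos_add, Real.cos_sub, Real.cos_pi_div_three]
    ring
  have hcosb : Real.cos (b * θ) = -1 / 2 := by
    rw [hbθ, Real.cos_add_int_mul_two_pi, cos_two_pi_div_three]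
  linarith

theorem neg_le_lambda_three_value : (-33 / 25 : ℝ) ≤ (-17 - 7 * Real.sqrt 7) / 27 := by
  have : Real.sqrt 7 ≤ 2.66 := Real.sqrt_le_iff.mpr (by norm_num)
  linarith

theorem cosSumAttainsLE_add {a b : ℕ} (ha : 0 < a) (hab : a < b) :
    CosSumAttainsLE ((-17 - 7 * Real.sqrt 7) / 27) a b (a + b) := by
  obtain ⟨a', b', hcop, ea, eb⟩ := Nat.exists_coprime a b
  have hg : 0 < Nat.gcd a b := Nat.gcd_pos_of_pos_left b ha
  generalize Nat.gcd a b = g at ea eb hg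
  have ha' : 0 < a' := Nat.pos_of_ne_zero fun h => by simp [h] at ea; omega
  have hab' : a' < b' := by
    rw [ea, eb] at hab
    exact Nat.lt_of_mul_lt_mul_right hab
  suffices h : CosSumAttainsLE ((-17 - 7 * Real.sqrt 7) / 27) a' b' (a' + b') by
    have := h.mul_left hg
    rwa [mul_add, mul_comm g a', mul_comm g b', ← ea, ← eb] at this
  rcases le_or_gt 6 b' with hb | hb
  · exact (cosSumAttainsLE_add_of_coprime hcop hb).mono neg_le_lambda_three_value
  · have h123 := cosSumAttainsLE_one_two_three
    obtain ⟨-, -, -, h13, h23, h14, h34, h15, h25, h35, h45⟩ := cosSumAttainsLE_sporadic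
    have hv := neg_le_lambda_three_value
    interval_cases b' <;> interval_cases a' <;>
      first
        | exact h123
        | exact h13.mono hv
        | exact h23.mono hv
        | exact h14.mono hv
        | exact h34.mono hv
        | exact h15.mono hv
        | exact h25.mono hv
        | exact h35.mono hv
        | exact h45.mono hv
        | (exfalso; revert hcop; decide)

theorem not_dvd_of_mul_lt_of_lt_mul {n m : ℤ} (hn : 0 < n) (j : ℤ) (h₁ : n * j < m)
    (h₂ : m < n * (j + 1)) : ¬ n ∣ m := by
  rintro ⟨k, rfl⟩
  have := lt_of_mul_lt_mul_left h₁ hn.le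
  have := lt_of_mul_lt_mul_left h₂ hn.le
  omega

/-- The frequencies `a, b, 2a`, averaged over the solutions of `cos (b θ) = -1`. -/
theorem cosSumAttainsLE_of_eq_two_mul_left {a b : ℕ} (hab : a < b) (hb : b < 2 * a) :
    CosSumAttainsLE (-33 / 25) a b (2 * a) := by
  by_cases h3 : 2 * b = 3 * a
  · obtain ⟨d, rfl⟩ : 2 ∣ a := by omega
    obtain rfl : b = d * 3 := by omega
    have := cosSumAttainsLE_sporadic.1.mul_left (d := d) (by omega)
    rwa [mul_comm 2 d, show 2 * (d * 2) = d * 4 by ring]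
  by_cases h4 : 3 * b = 4 * a
  · obtain ⟨d, rfl⟩ : 3 ∣ a := by omega
    obtain rfl : b = d * 4 := by omega
    have := cosSumAttainsLE_sporadic.2.1.mul_left (d := d) (by omega)
    rwa [mul_comm 3 d, show 2 * (d * 3) = d * 6 by ring]
  have hb0 : (0 : ℤ) < b := by omega
  have h2a : ¬ (b : ℤ) ∣ 2 * a := not_dvd_of_mul_lt_of_lt_mul hb0 1 (by omega) (by omega)
  have h3a : ¬ (b : ℤ) ∣ a + 2 * a := by
    rintro ⟨k, hk⟩
    have : 1 < k := by nlinarith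
    have : k < 3 := by nlinarith
    obtain rfl : k = 2 := by omega
    omega
  have h4a : ¬ (b : ℤ) ∣ 2 * (2 * a) := by
    rintro ⟨k, hk⟩
    have : 2 < k := by nlinarith
    have : k < 4 := by nlinarith
    obtain rfl : k = 3 := by omega
    omega
  have ha : ¬ (b : ℤ) ∣ a := not_dvd_of_mul_lt_of_lt_mul hb0 0 (by omega) (by omega)
  obtain ⟨θ, h₁, h₂⟩ := exists_cos_add_cos_lt (n := b) (by omega) ha h2a h2a h4a h3a
    (not_dvd_of_mul_lt_of_lt_mul hb0 (-1) (by omega) (by omega))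
  refine ⟨θ, ?_⟩
  push_cast at h₂ ⊢
  linarith

/-- The frequencies `a, b, 2b`, averaged over the solutions of `b θ = 2π/3`. -/
theorem cosSumAttainsLE_of_eq_two_mul_right {a b : ℕ} (ha : 0 < a) (hab : a < b) :
    CosSumAttainsLE (-33 / 25) a b (2 * b) := by
  by_cases h2 : b = 2 * a
  · have := cosSumAttainsLE_sporadic.2.2.1.mul_left ha
    rwa [mul_one, show a * 2 = b by omega, show a * 4 = 2 * b by omega] at this
  have hb0 : (0 : ℤ) < b := by omega
  have h2a : ¬ (b : ℤ) ∣ 2 * a := by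
    rintro ⟨k, hk⟩
    have : 0 < k := by nlinarith
    have : k < 2 := by nlinarith
    obtain rfl : k = 1 := by omega
    omega
  obtain ⟨θ, ⟨k, hk⟩, h⟩ := exists_cos_lt (n := b) (by omega)
    (not_dvd_of_mul_lt_of_lt_mul hb0 0 (by omega) (by omega)) h2a (2 * Real.pi / 3)
  refine ⟨θ, ?_⟩
  have hcosb : Real.cos (b * θ) = -1 / 2 := by
    rw [hk, Real.cos_add_nat_mul_two_pi, cos_two_pi_div_three]
  push_cast at h ⊢
  rw [mul_assoc, Real.cos_two_mul, hcosb]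
  linarith

theorem cosSumAttainsLE_lambda_three {a b c : ℕ} (ha : 0 < a) (hab : a < b) (hbc : b < c) :
    CosSumAttainsLE ((-17 - 7 * Real.sqrt 7) / 27) a b c := by
  have hv := neg_le_lambda_three_value
  by_cases h1 : c = a + b
  · exact h1 ▸ cosSumAttainsLE_add ha hab
  by_cases h2 : c = 2 * a
  · subst h2
    exact (cosSumAttainsLE_of_eq_two_mul_left hab hbc).mono hv
  by_cases h3 : c = 2 * b
  · subst h3
    exact (cosSumAttainsLE_of_eq_two_mul_right ha hab).mono hv
  have hc0 : (0 : ℤ) < c := by omega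
  have hdvd (m : ℤ) (hm0 : 0 < m) (hm2 : m < 2 * c) (hmc : m ≠ c) : ¬ (c : ℤ) ∣ m := by
    rintro ⟨k, hk⟩
    have : 0 < k := by nlinarith
    have : k < 2 := by nlinarith
    obtain rfl : k = 1 := by omega
    omega
  obtain ⟨θ, h₁, h₂⟩ := exists_cos_add_cos_lt (n := c) (p := b) (q := a) (by omega)
    (hdvd _ (by omega) (by omega) (by omega)) (hdvd _ (by omega) (by omega) (by omega))
    (hdvd _ (by omega) (by omega) (by omega)) (hdvd _ (by omega) (by omega) (by omega))
    (hdvd _ (by omega) (by omega) (by omega)) (hdvd _ (by omega) (by omega) (by omega))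
  refine ⟨θ, ?_⟩
  push_cast at h₂
  linarith

theorem CosSumAttainsLE.iInf_le {v : ℝ} {a b c : ℕ} (h : CosSumAttainsLE v a b c) :
    ⨅ θ : ℝ, (Real.cos (a * θ) + Real.cos (b * θ) + Real.cos (c * θ)) ≤ v := by
  obtain ⟨θ, hθ⟩ := h
  refine (ciInf_le ⟨-3, ?_⟩ θ).trans hθ
  rintro _ ⟨φ, rfl⟩
  have := Real.neg_one_le_cos (a * φ)
  have := Real.neg_one_le_cos (b * φ)
  have := Real.neg_one_le_cos (c * φ)
  dsimp only
  linarith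

theorem lambda_three :
    IsGreatest {m : ℝ | ∃ a₁ a₂ a₃ : ℕ, 0 < a₁ ∧ a₁ < a₂ ∧ a₂ < a₃ ∧
      m = ⨅ θ : ℝ, (Real.cos (a₁ * θ) + Real.cos (a₂ * θ) + Real.cos (a₃ * θ))}
      ((-17 - 7 * Real.sqrt 7) / 27) ∧
    (⨅ θ : ℝ, (Real.cos ((1 : ℕ) * θ) + Real.cos ((2 : ℕ) * θ) +
      Real.cos ((3 : ℕ) * θ))) = (-17 - 7 * Real.sqrt 7) / 27 := by
  have h123 : (⨅ θ : ℝ, (Real.cos ((1 : ℕ) * θ) + Real.cos ((2 : ℕ) * θ) +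
      Real.cos ((3 : ℕ) * θ))) = (-17 - 7 * Real.sqrt 7) / 27 :=
    le_antisymm cosSumAttainsLE_one_two_three.iInf_le (le_ciInf neg_le_cos_sum_one_two_three)
  refine ⟨⟨⟨1, 2, 3, by norm_num, by norm_num, by norm_num, h123.symm⟩, ?_⟩, h123⟩
  rintro _ ⟨a, b, c, ha, hab, hbc, rfl⟩
  exact (cosSumAttainsLE_lambda_three ha hab hbc).iInf_le
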